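/- arXiv:2401.13390 — 2 statements merged into one kernel-verified Lean document; each statement's English description precedes it below -/
import Mathlib

section
/- Let G be a concurrent stochastic game with countable state set S, a sink state ⊥, countable Min action sets, and with A(s) finite for every s ∈ S. Then Max has a single memoryless strategy σ that is optimal for the safety objective Avoid(⊥) from every state: for all s ∈ S and all Min strategies π, P_{s,σ,π}(Avoid(⊥)) ≥ val(Avoid(⊥), s). -/
open scoped ENNReal Classical

/-- One step of a play: a state together with the actions chosen by Max and Min there. -/
structure Step (S A B : Type) where
  st : S
  ac : A
  bc : B

instance {S A B : Type} : MeasurableSpace (Step S A B) := ⊤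

/-- A history: the list of past steps together with the current (final) state. -/
abbrev Hist (S A B : Type) := List (Step S A B) × S

/-- An infinite play. -/
abbrev Play (S A B : Type) := ℕ → Step S A B

/-- A concurrent stochastic game: action sets for Max and Min at each state
(nonempty; countability is imposed via `Countable` instances on `S`, `A`, `B`),
and a transition probability distribution for each state and pair of actions. -/
structure Game (S A B : Type) where
  actA : S → Set A
  actB : S → Set B
  actA_nonempty : ∀ s, (actA s).Nonempty
  actB_nonempty : ∀ s, (actB s).Nonempty
  p : S → A → B → PMF S

namespace Game

variable {S A B : Type}

/-- A Max strategy assigns to each history a mixed action on the Max actions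
available at the final state of the history. -/
def IsMaxStrategy (G : Game S A B) (σ : Hist S A B → PMF A) : Prop :=
  ∀ h : Hist S A B, (σ h).support ⊆ G.actA h.2

/-- A Min strategy assigns to each history a mixed action on the Min actions
available at the final state of the history. -/
def IsMinStrategy (G : Game S A B) (π : Hist S A B → PMF B) : Prop :=
  ∀ h : Hist S A B, (π h).support ⊆ G.actB h.2

/-- A sink state: all transitions from it return to it with probability 1. -/
def IsSink (G : Game S A B) (s : S) : Prop := ∀ a b, G.p s a b s = 1

/-- A history is valid if all actions taken in it were available. -/
def ValidHist (G : Game S A B) (h : Hist S A B) : Prop :=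
  ∀ z ∈ h.1, z.ac ∈ G.actA z.st ∧ z.bc ∈ G.actB z.st

/-- Transition function extended to a mixed Max action and a pure Min action. -/
noncomputable def pA (G : Game S A B) (s : S) (α : PMF A) (b : B) : PMF S :=
  α.bind fun a => G.p s a b

/-- Transition function extended to mixed actions of both players. -/
noncomputable def pAB (G : Game S A B) (s : S) (α : PMF A) (β : PMF B) : PMF S :=
  α.bind fun a => β.bind fun b => G.p s a b

/-- The state reached after the current position: the state of the next listed
step, or the given final state if no steps remain. -/
def nextState : List (Step S A B) → S → S
  | [], t => t
  | z :: _, _ => z.st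

/-- Auxiliary recursion computing the probability of a history:
`pre` is the already-consumed prefix, `cur` the current state, and the
remaining steps and final state are processed from the left. -/
noncomputable def histProbAux (G : Game S A B)
    (σ : Hist S A B → PMF A) (π : Hist S A B → PMF B) :
    List (Step S A B) → S → List (Step S A B) → S → ℝ≥0∞
  | _, cur, [], t => if t = cur then 1 else 0
  | pre, cur, z :: rest, t =>
    if z.st = cur then
      σ (pre, cur) z.ac * π (pre, cur) z.bc *
        G.p z.st z.ac z.bc (nextState rest t) *
        histProbAux G σ π (pre ++ [z]) (nextState rest t) rest t
    else 0

/-- The probability of (the cylinder of) a history under strategies σ, π from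
initial state `s0`. -/
noncomputable def histProb (G : Game S A B)
    (σ : Hist S A B → PMF A) (π : Hist S A B → PMF B) (s0 : S) (h : Hist S A B) : ℝ≥0∞ :=
  G.histProbAux σ π [] s0 h.1 h.2

end Game

/-- The cylinder set of plays extending a given history. -/
def cylinder {S A B : Type} (h : Hist S A B) : Set (Play S A B) :=
  {ω | (∀ i : Fin h.1.length, ω i = h.1.get i) ∧ (ω h.1.length).st = h.2}

/-- A strategy is memoryless if its choice depends only on the final state. -/
def Memoryless {S A B X : Type} (σ : Hist S A B → X) : Prop :=
  ∀ h h' : Hist S A B, h.2 = h'.2 → σ h = σ h'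

/-- The event that the play visits state `t`. -/
def Reaches {S A B : Type} (t : S) : Set (Play S A B) := {ω | ∃ i, (ω i).st = t}

/-- The event that the play never visits state `t`. -/
def Avoids {S A B : Type} (t : S) : Set (Play S A B) := {ω | ∀ i, (ω i).st ≠ t}

/-- The event that the play visits state `t` within at most `n` steps. -/
def ReachesWithin {S A B : Type} (t : S) (n : ℕ) : Set (Play S A B) :=
  {ω | ∃ i ≤ n, (ω i).st = t}

/-- Expectation of `v : S → ℝ≥0∞` with respect to a distribution on `S`. -/
noncomputable def expE {S : Type} (μ : PMF S) (v : S → ℝ≥0∞) : ℝ≥0∞ := ∑' t, μ t * v t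

/-- Expectation of a real-valued `v` with respect to a distribution on `S`. -/
noncomputable def expR {S : Type} (μ : PMF S) (v : S → ℝ) : ℝ := ∑' t, (μ t).toReal * v t

/-- The mass a distribution assigns to a set of states. -/
noncomputable def massOf {S : Type} (μ : PMF S) (T : Set S) : ℝ≥0∞ :=
  ∑' t, T.indicator (⇑μ) t

namespace Game

variable {S A B : Type}

/-- `μ` is the probability measure on plays induced by strategies σ, π from
initial state `s0` (characterized on cylinder sets, by Carathéodory's
extension theorem). -/
def IsPlayMeasure (G : Game S A B) (σ : Hist S A B → PMF A) (π : Hist S A B → PMF B)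
    (s0 : S) (μ : MeasureTheory.Measure (Play S A B)) : Prop :=
  MeasureTheory.IsProbabilityMeasure μ ∧
    ∀ h : Hist S A B, μ (cylinder h) = G.histProb σ π s0 h

/-- The (lower) value `sup_σ inf_π P_{s,σ,π}(E)` of objective `E` from state `s`,
relative to the family `P` of induced play measures. -/
noncomputable def val (G : Game S A B)
    (P : (Hist S A B → PMF A) → (Hist S A B → PMF B) → S →
      MeasureTheory.Measure (Play S A B))
    (E : Set (Play S A B)) (s : S) : ℝ≥0∞ :=
  ⨆ σ ∈ {σ | G.IsMaxStrategy σ}, ⨅ π ∈ {π | G.IsMinStrategy π}, P σ π s E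

/-- The set of states from which Max has an optimal strategy for `Reaches top`. -/
def OptStates (G : Game S A B)
    (P : (Hist S A B → PMF A) → (Hist S A B → PMF B) → S →
      MeasureTheory.Measure (Play S A B))
    (top : S) : Set S :=
  {s | ∃ σ, G.IsMaxStrategy σ ∧ ∀ π, G.IsMinStrategy π →
      P σ π s (Reaches top) ≥ G.val P (Reaches top) s}

/-- A mixed Max action `α` at `s` is optimality-preserving if every Min action
gives expected value at least the value of `s`, and in case of equality the
successor distribution is supported on states admitting optimal strategies. -/
def OptPreserving (G : Game S A B)
    (P : (Hist S A B → PMF A) → (Hist S A B → PMF B) → S →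
      MeasureTheory.Measure (Play S A B))
    (top : S) (s : S) (α : PMF A) : Prop :=
  ∀ b ∈ G.actB s,
    G.val P (Reaches top) s ≤ expE (G.pA s α b) (G.val P (Reaches top)) ∧
    (expE (G.pA s α b) (G.val P (Reaches top)) = G.val P (Reaches top) s →
      (G.pA s α b).support ⊆ G.OptStates P top)

/-- A Min action `b` is value-preserving at `s` against the mixed action `α`. -/
def ValuePres (G : Game S A B)
    (P : (Hist S A B → PMF A) → (Hist S A B → PMF B) → S →
      MeasureTheory.Measure (Play S A B))
    (top : S) (s : S) (α : PMF A) (b : B) : Prop :=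
  expE (G.pA s α b) (G.val P (Reaches top)) = G.val P (Reaches top) s

end Game

namespace Game

open Filter Topology
open MeasureTheory hiding cylinder

variable {S A B : Type}

/-- The mixed Max actions available at `s`. -/
abbrev MixedMax (G : Game S A B) (s : S) : Type := {α : PMF A // α.support ⊆ G.actA s}

instance (G : Game S A B) (s : S) : Nonempty (G.MixedMax s) := by
  obtain ⟨a, ha⟩ := G.actA_nonempty s
  exact ⟨⟨PMF.pure a, by simpa using ha⟩⟩

/-- The probability of avoiding `bot` during the next `n` steps after a given history. -/
noncomputable def avoidWithin (G : Game S A B) (bot : S) (σ : Hist S A B → PMF A)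
    (π : Hist S A B → PMF B) : ℕ → Hist S A B → ℝ≥0∞
  | 0, h => if h.2 = bot then 0 else 1
  | n + 1, h => if h.2 = bot then 0 else
      ∑' b, ∑' a, ∑' t, σ h a * π h b * G.p h.2 a b t *
        avoidWithin G bot σ π n (h.1 ++ [⟨h.2, a, b⟩], t)

/-- The value of the game in which Max has to avoid `bot` for `n` steps. -/
noncomputable def safeVal (G : Game S A B) (bot : S) : ℕ → S → ℝ≥0∞
  | 0, s => if s = bot then 0 else 1
  | n + 1, s => if s = bot then 0 else
      ⨆ α : G.MixedMax s, ⨅ b : G.actB s, expE (G.pA s α b) (safeVal G bot n)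

lemma tsum_tsum_mul_eq_expE (G : Game S A B) (s : S) (α : PMF A) (b : B) (u : S → ℝ≥0∞) :
    ∑' a, ∑' t, α a * G.p s a b t * u t = expE (G.pA s α b) u := by
  unfold expE pA
  simp only [PMF.bind_apply, ← ENNReal.tsum_mul_right]
  exact ENNReal.tsum_comm

lemma expE_pA_eq (G : Game S A B) (s : S) (α : PMF A) (b : B) (u : S → ℝ≥0∞) :
    expE (G.pA s α b) u = ∑' a, α a * expE (G.p s a b) u := by
  rw [← tsum_tsum_mul_eq_expE]
  simp only [expE, mul_assoc, ENNReal.tsum_mul_left]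

lemma expE_mono (μ : PMF S) {u v : S → ℝ≥0∞} (h : u ≤ v) : expE μ u ≤ expE μ v :=
  ENNReal.tsum_le_tsum fun t => mul_le_mul_right (h t) _

lemma expE_const (μ : PMF S) (c : ℝ≥0∞) : expE μ (fun _ => c) = c := by
  simp [expE, ENNReal.tsum_mul_right, μ.tsum_coe]

lemma expE_le_one (μ : PMF S) {u : S → ℝ≥0∞} (h : ∀ s, u s ≤ 1) : expE μ u ≤ 1 :=
  (expE_mono μ h).trans (expE_const μ 1).le

lemma expE_add (μ : PMF S) (u v : S → ℝ≥0∞) :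
    expE μ (fun t => u t + v t) = expE μ u + expE μ v := by
  simp [expE, mul_add, ENNReal.tsum_add]

lemma expE_iInf (μ : PMF S) {u : ℕ → S → ℝ≥0∞} (hu : Antitone u) (h1 : ∀ s, u 0 s ≤ 1) :
    expE μ (fun t => ⨅ n, u n t) = ⨅ n, expE μ (u n) := by
  let _ : MeasurableSpace S := ⊤
  have key := lintegral_iInf (μ := Measure.count) (f := fun n t => μ t * u n t)
    (fun n => measurable_from_top) (fun m n hmn t => mul_le_mul_right (hu hmn t) _)
    (by
      rw [lintegral_count]
      exact ne_top_of_le_ne_top ENNReal.one_ne_top (expE_le_one μ h1))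
  simp only [lintegral_count] at key
  unfold expE
  rw [← key]
  refine tsum_congr fun t => ?_
  exact ENNReal.mul_iInf fun h => (μ.apply_ne_top t h).elim

lemma safeVal_le_one (G : Game S A B) (bot : S) (n : ℕ) (s : S) : G.safeVal bot n s ≤ 1 := by
  induction n generalizing s with
  | zero => unfold safeVal; split_ifs <;> simp
  | succ n ih =>
    unfold safeVal
    split_ifs
    · simp
    · obtain ⟨b, hb⟩ := G.actB_nonempty s
      exact iSup_le fun α => (iInf_le _ ⟨b, hb⟩).trans (expE_le_one _ ih)

lemma safeVal_antitone (G : Game S A B) (bot : S) : Antitone (G.safeVal bot) := by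
  refine antitone_nat_of_succ_le fun n => ?_
  induction n with
  | zero =>
    intro s
    have := G.safeVal_le_one bot 1 s
    by_cases h : s = bot <;> simp_all [safeVal]
  | succ n ih =>
    intro s
    rw [safeVal, safeVal]
    split_ifs
    · simp
    · exact iSup_mono fun α => iInf_mono fun b => expE_mono _ ih

/-- Since Max has finitely many actions, the limit of the finite horizon values admits a
locally optimal mixed action. -/
lemma exists_mixed_le_expE (G : Game S A B) (bot s : S) (hA : (G.actA s).Finite) :
    ∃ α : G.MixedMax s, ∀ b ∈ G.actB s,
      ⨅ n, G.safeVal bot n s ≤ expE (G.pA s α b) (fun t => ⨅ n, G.safeVal bot n t) := by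
  by_cases hs : s = bot
  · refine ⟨Classical.arbitrary _, fun b _ => (iInf_le _ 0).trans ?_⟩
    simp [safeVal, hs]
  set w := ⨅ n, G.safeVal bot n s
  have hw : ∀ n, w ≤ G.safeVal bot n s := fun n => iInf_le _ n
  have hw_top : w ≠ ⊤ := ne_top_of_le_ne_top ENNReal.one_ne_top
    ((hw 0).trans (G.safeVal_le_one bot 0 s))
  have approx : ∀ n : ℕ, ∃ α : G.MixedMax s, ∀ b ∈ G.actB s,
      w ≤ expE (G.pA s α b) (G.safeVal bot n) + (n : ℝ≥0∞)⁻¹ := by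
    intro n
    have hlt : w < (⨆ α : G.MixedMax s, ⨅ b : G.actB s,
        expE (G.pA s α b) (G.safeVal bot n)) + (n : ℝ≥0∞)⁻¹ := by
      have h := hw (n + 1)
      rw [safeVal, if_neg hs] at h
      refine lt_of_lt_of_le (ENNReal.lt_add_right hw_top ?_) (add_le_add_left h _)
      exact ENNReal.inv_ne_zero.2 (ENNReal.natCast_ne_top n)
    rw [ENNReal.iSup_add] at hlt
    obtain ⟨α, hα⟩ := lt_iSup_iff.1 hlt
    refine ⟨α, fun b hb => hα.le.trans (add_le_add_left ?_ _)⟩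
    exact iInf_le (fun b : G.actB s => expE (G.pA s α b) (G.safeVal bot n)) ⟨b, hb⟩
  choose α hα using approx
  let U : Ultrafilter ℕ := hyperfilter ℕ
  have hU : (U : Filter ℕ) ≤ atTop := Nat.hyperfilter_le_atTop
  have hlim : ∀ a, ∃ x : ℝ≥0∞, Tendsto (fun n => (α n : PMF A) a) U (𝓝 x) := fun a => by
    obtain ⟨x, -, hx⟩ := isCompact_univ.ultrafilter_le_nhds (U.map fun n => (α n : PMF A) a)
      (by simp)
    exact ⟨x, hx⟩
  choose x hx using hlim
  have hα0 : ∀ n, ∀ a ∉ hA.toFinset, (α n : PMF A) a = 0 := fun n a ha => by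
    by_contra h
    exact ha (hA.mem_toFinset.2 ((α n).2 ((PMF.mem_support_iff _ _).2 h)))
  have hx0 : ∀ a ∉ hA.toFinset, x a = 0 := fun a ha =>
    tendsto_nhds_unique (hx a) (by simp [hα0 _ a ha])
  have hsum : ∑ a ∈ hA.toFinset, x a = 1 := by
    refine tendsto_nhds_unique (tendsto_finsetSum _ fun a _ => hx a) ?_
    have : ∀ n, ∑ a ∈ hA.toFinset, (α n : PMF A) a = 1 := fun n => by
      exact (tsum_eq_sum (hα0 n)).symm.trans (α n : PMF A).tsum_coe
    simp [this]
  let β : PMF A := PMF.ofFinset x hA.toFinset hsum hx0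
  have hβ : ∀ a, β a = x a := fun a => rfl
  refine ⟨⟨β, fun a ha => ?_⟩, fun b hb => ?_⟩
  · by_contra h
    exact (PMF.mem_support_iff _ _).1 ha (hx0 a (by simpa using h))
  · rw [expE_iInf _ (G.safeVal_antitone bot) (G.safeVal_le_one bot 0)]
    refine le_iInf fun m => ?_
    have ht : Tendsto (fun n : ℕ => expE (G.pA s (α n) b) (G.safeVal bot m) + (n : ℝ≥0∞)⁻¹) U
        (𝓝 (expE (G.pA s β b) (G.safeVal bot m) + 0)) := by
      refine Tendsto.add ?_ (ENNReal.tendsto_inv_nat_nhds_zero.mono_left hU)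
      simp only [expE_pA_eq]
      rw [tsum_eq_sum (s := hA.toFinset) fun a ha => by rw [hβ, hx0 a ha, zero_mul]]
      have : ∀ n, ∑' a, (α n : PMF A) a * expE (G.p s a b) (G.safeVal bot m) =
          ∑ a ∈ hA.toFinset, (α n : PMF A) a * expE (G.p s a b) (G.safeVal bot m) := fun n =>
        tsum_eq_sum fun a ha => by rw [hα0 n a ha, zero_mul]
      simp only [this]
      exact tendsto_finsetSum _ fun a _ => ENNReal.Tendsto.mul_const (hx a)
        (Or.inr (ne_top_of_le_ne_top ENNReal.one_ne_top
          (expE_le_one _ (G.safeVal_le_one bot m))))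
    rw [add_zero] at ht
    refine ge_of_tendsto ht ?_
    filter_upwards [hU (eventually_ge_atTop m)] with n hn
    exact (hα n b hb).trans (add_le_add_left (expE_mono _ (G.safeVal_antitone bot hn)) _)

lemma le_tsum_pmf_mul (μ : PMF B) {c : ℝ≥0∞} {f : B → ℝ≥0∞} (h : ∀ b ∈ μ.support, c ≤ f b) :
    c ≤ ∑' b, μ b * f b := by
  calc c = ∑' b, μ b * c := (expE_const μ c).symm
    _ ≤ _ := ENNReal.tsum_le_tsum fun b => by
      by_cases hb : μ b = 0
      · simp [hb]
      · exact mul_le_mul_right (h b ((PMF.mem_support_iff _ _).2 hb)) _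

lemma tsum_pmf_mul_le (μ : PMF B) {c : ℝ≥0∞} {f : B → ℝ≥0∞} (h : ∀ b ∈ μ.support, f b ≤ c) :
    ∑' b, μ b * f b ≤ c := by
  calc ∑' b, μ b * f b ≤ ∑' b, μ b * c := ENNReal.tsum_le_tsum fun b => by
        by_cases hb : μ b = 0
        · simp [hb]
        · exact mul_le_mul_right (h b ((PMF.mem_support_iff _ _).2 hb)) _
    _ = c := expE_const μ c

lemma tsum_step_eq (G : Game S A B) (s : S) (α : PMF A) (β : PMF B) (u : S → A → B → ℝ≥0∞) :
    ∑' b, ∑' a, ∑' t, α a * β b * G.p s a b t * u t a b =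
      ∑' b, β b * ∑' a, ∑' t, α a * G.p s a b t * u t a b := by
  simp only [← ENNReal.tsum_mul_left]
  refine tsum_congr fun b => tsum_congr fun a => tsum_congr fun t => ?_
  ring

/-- A submartingale bound: local optimality of `σ` for `u` bounds avoidance from below. -/
lemma le_avoidWithin (G : Game S A B) {bot : S} {σ : Hist S A B → PMF A}
    {π : Hist S A B → PMF B} (hπ : G.IsMinStrategy π) {u : S → ℝ≥0∞} (hu : ∀ s, u s ≤ 1)
    (hbot : u bot = 0) (hσ : ∀ h : Hist S A B, ∀ b ∈ G.actB h.2, u h.2 ≤ expE (G.pA h.2 (σ h) b) u)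
    (n : ℕ) (h : Hist S A B) : u h.2 ≤ G.avoidWithin bot σ π n h := by
  induction n generalizing h with
  | zero =>
    rw [avoidWithin]
    split_ifs with hs
    · simp [hs, hbot]
    · exact hu _
  | succ n ih =>
    rw [avoidWithin]
    split_ifs with hs
    · simp [hs, hbot]
    · rw [G.tsum_step_eq h.2 (σ h) (π h)
        (fun t a b => G.avoidWithin bot σ π n (h.1 ++ [Step.mk h.2 a b], t))]
      refine le_tsum_pmf_mul _ fun b hb => (hσ h b (hπ h hb)).trans ?_
      rw [← tsum_tsum_mul_eq_expE]
      exact ENNReal.tsum_le_tsum fun a => ENNReal.tsum_le_tsum fun t =>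
        mul_le_mul_right (ih (h.1 ++ [⟨h.2, a, b⟩], t)) _

/-- Against any Max strategy, Min can push the `N`-step avoidance probability down to the
`N`-step value, up to an arbitrarily small error. -/
lemma exists_min_avoidWithin_le (G : Game S A B) (bot : S) (σ : Hist S A B → PMF A)
    (hσ : G.IsMaxStrategy σ) (N : ℕ) {ε : ℝ≥0∞} (hε : ε ≠ 0) :
    ∃ π, G.IsMinStrategy π ∧ ∀ s,
      G.avoidWithin bot σ π N ([], s) ≤ G.safeVal bot N s + N * ε := by
  have local_choice : ∀ h : Hist S A B, ∃ b ∈ G.actB h.2, h.2 ≠ bot →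
      expE (G.pA h.2 (σ h) b) (G.safeVal bot (N - h.1.length - 1)) ≤
        G.safeVal bot (N - h.1.length - 1 + 1) h.2 + ε := by
    intro h
    by_cases hs : h.2 = bot
    · obtain ⟨b, hb⟩ := G.actB_nonempty h.2
      exact ⟨b, hb, fun h' => (h' hs).elim⟩
    · set k := N - h.1.length - 1
      have hle : ⨅ b : G.actB h.2, expE (G.pA h.2 (σ h) b) (G.safeVal bot k) ≤
          G.safeVal bot (k + 1) h.2 := by
        rw [safeVal, if_neg hs]
        exact le_iSup (fun α : G.MixedMax h.2 => ⨅ b : G.actB h.2,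
          expE (G.pA h.2 α b) (G.safeVal bot k)) ⟨σ h, hσ h⟩
      have hlt := hle.trans_lt (ENNReal.lt_add_right
        (ne_top_of_le_ne_top ENNReal.one_ne_top (G.safeVal_le_one bot (k + 1) h.2)) hε)
      obtain ⟨b, hb⟩ := iInf_lt_iff.1 hlt
      exact ⟨b, b.2, fun _ => hb.le⟩
  choose c hc hval using local_choice
  refine ⟨fun h => PMF.pure (c h), fun h => by simpa using hc h, ?_⟩
  suffices key : ∀ n (h : Hist S A B), h.1.length + n = N →
      G.avoidWithin bot σ (fun h => PMF.pure (c h)) n h ≤ G.safeVal bot n h.2 + n * ε from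
    fun s => key N ([], s) (by simp)
  intro n
  induction n with
  | zero => intro h _; simp [avoidWithin, safeVal]
  | succ n ih =>
    intro h hN
    rw [avoidWithin]
    split_ifs with hs
    · simp
    rw [G.tsum_step_eq h.2 (σ h) (PMF.pure (c h))
      (fun t a b => G.avoidWithin bot σ (fun h => PMF.pure (c h)) n
        (h.1 ++ [Step.mk h.2 a b], t))]
    refine tsum_pmf_mul_le _ fun b hb => ?_
    obtain rfl : b = c h := by simpa using hb
    calc _ ≤ ∑' a, ∑' t, σ h a * G.p h.2 a (c h) t * (G.safeVal bot n t + n * ε) :=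
          ENNReal.tsum_le_tsum fun a => ENNReal.tsum_le_tsum fun t =>
            mul_le_mul_right (ih (h.1 ++ [⟨h.2, a, c h⟩], t) (by simp; omega)) _
      _ = expE (G.pA h.2 (σ h) (c h)) (G.safeVal bot n) + n * ε := by
          rw [G.tsum_tsum_mul_eq_expE h.2 (σ h) (c h) fun t => G.safeVal bot n t + n * ε,
            expE_add, expE_const]
      _ ≤ G.safeVal bot (n + 1) h.2 + ε + n * ε := by
          have := hval h hs
          rw [show N - h.1.length - 1 = n by omega] at this
          exact add_le_add_left this _
      _ = _ := by push_cast; ring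

lemma histProbAux_append (G : Game S A B) (σ : Hist S A B → PMF A) (π : Hist S A B → PMF B)
    (pre rest : List (Step S A B)) (cur s t : S) (a : A) (b : B) :
    G.histProbAux σ π pre cur (rest ++ [⟨s, a, b⟩]) t =
      G.histProbAux σ π pre cur rest s *
        (σ (pre ++ rest, s) a * π (pre ++ rest, s) b * G.p s a b t) := by
  induction rest generalizing pre cur with
  | nil =>
    by_cases h : s = cur
    · subst h
      simp [histProbAux, nextState]
    · simp [histProbAux, h]
  | cons z rest ih =>
    have hn : nextState (rest ++ [⟨s, a, b⟩]) t = nextState rest s := by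
      cases rest <;> rfl
    simp only [List.cons_append, histProbAux, hn, ih]
    split_ifs
    · simp only [List.append_assoc, List.cons_append, List.nil_append]
      ring
    · simp

lemma mem_cylinder_snoc {pre : List (Step S A B)} {z : Step S A B} {t : S} {ω : Play S A B} :
    ω ∈ cylinder (pre ++ [z], t) ↔
      ω ∈ cylinder (pre, z.st) ∧ ω pre.length = z ∧ (ω (pre.length + 1)).st = t := by
  simp only [cylinder, Set.mem_ofPred_eq, List.get_eq_getElem, List.length_append,
    List.length_singleton, Fin.forall_iff]
  constructor
  · rintro ⟨h, ht⟩
    have hz : ω pre.length = z := by simpa using h pre.length (by simp)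
    refine ⟨⟨fun i hi => ?_, by rw [hz]⟩, hz, ht⟩
    rw [h i (by omega), List.getElem_append_left hi]
  · rintro ⟨⟨h, -⟩, hz, ht⟩
    refine ⟨fun i hi => ?_, ht⟩
    rcases Nat.lt_succ_iff_lt_or_eq.1 hi with hi' | rfl
    · rw [h i hi', List.getElem_append_left hi']
    · simpa using hz

lemma measurableSet_state (k : ℕ) (T : Set S) :
    MeasurableSet {ω : Play S A B | (ω k).st ∈ T} := by
  have h : Measurable fun ω : Play S A B => ω k := measurable_pi_apply k
  exact h (t := {z | z.st ∈ T}) trivial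

lemma measurableSet_cylinder (h : Hist S A B) : MeasurableSet (cylinder h) := by
  refine MeasurableSet.inter ?_ (measurableSet_state _ {h.2})
  change MeasurableSet {ω : Play S A B | ∀ i : Fin h.1.length, ω i = h.1.get i}
  rw [Set.ofPred_forall]
  refine MeasurableSet.iInter fun i => ?_
  have hi : Measurable fun ω : Play S A B => ω i := measurable_pi_apply _
  exact hi (t := {h.1.get i}) trivial

/-- The plays avoiding `bot` from position `k` to position `k + n`. -/
def avoidWindow (bot : S) (k n : ℕ) : Set (Play S A B) :=
  {ω | ∀ i, k ≤ i → i ≤ k + n → (ω i).st ≠ bot}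

lemma measurableSet_avoidWindow (bot : S) (k n : ℕ) :
    MeasurableSet (avoidWindow bot k n : Set (Play S A B)) := by
  have : (avoidWindow bot k n : Set (Play S A B)) =
      ⋂ i, ⋂ (_ : k ≤ i), ⋂ (_ : i ≤ k + n), {ω | (ω i).st ∈ ({bot}ᶜ : Set S)} := by
    ext ω; simp [avoidWindow]
  rw [this]
  exact MeasurableSet.iInter fun i => MeasurableSet.iInter fun _ => MeasurableSet.iInter fun _ =>
    measurableSet_state i _

lemma measure_cylinder_inter_avoidWindow [Countable S] [Countable A] [Countable B]
    (G : Game S A B) (bot : S) {σ : Hist S A B → PMF A} {π : Hist S A B → PMF B} {s : S}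
    {μ : Measure (Play S A B)} (hμ : G.IsPlayMeasure σ π s μ) (n : ℕ) (h : Hist S A B) :
    μ (cylinder h ∩ avoidWindow bot h.1.length n) =
      μ (cylinder h) * G.avoidWithin bot σ π n h := by
  induction n generalizing h with
  | zero =>
    rw [avoidWithin]
    split_ifs with hs
    · rw [mul_zero]
      convert measure_empty (μ := μ)
      refine Set.eq_empty_of_forall_notMem fun ω hω => ?_
      exact hω.2 _ le_rfl (by simp) (hω.1.2.trans hs)
    · rw [mul_one, Set.inter_eq_left.2]
      intro ω hω i hi hi'
      obtain rfl : i = h.1.length := by omega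
      rwa [hω.2]
  | succ n ih =>
    obtain ⟨pre, cur⟩ := h
    rw [avoidWithin]
    dsimp only
    split_ifs with hs
    · rw [mul_zero]
      convert measure_empty (μ := μ)
      refine Set.eq_empty_of_forall_notMem fun ω hω => ?_
      exact hω.2 _ le_rfl (by simp) (hω.1.2.trans hs)
    let next : B × A × S → Hist S A B := fun q => (pre ++ [⟨cur, q.2.1, q.1⟩], q.2.2)
    have hmem : ∀ q ω, ω ∈ cylinder (next q) ↔ ω ∈ cylinder (pre, cur) ∧
        ω pre.length = ⟨cur, q.2.1, q.1⟩ ∧ (ω (pre.length + 1)).st = q.2.2 :=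
      fun q ω => mem_cylinder_snoc
    have hsplit : cylinder (pre, cur) ∩ avoidWindow bot pre.length (n + 1) =
        ⋃ q, cylinder (next q) ∩ avoidWindow bot (next q).1.length n := by
      ext ω
      simp only [Set.mem_inter_iff, Set.mem_iUnion, hmem, next, List.length_append,
        List.length_singleton]
      constructor
      · rintro ⟨hc, hw⟩
        have hst : (ω pre.length).st = cur := hc.2
        refine ⟨((ω pre.length).bc, (ω pre.length).ac, (ω (pre.length + 1)).st),
          ⟨hc, ?_, rfl⟩, fun i hi hi' => hw i (by omega) (by omega)⟩
        rw [← hst]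
      · rintro ⟨q, ⟨hc, -, -⟩, hw⟩
        refine ⟨hc, fun i hi hi' => ?_⟩
        rcases hi.eq_or_lt with rfl | hlt
        · rw [show (ω pre.length).st = cur from hc.2]
          exact hs
        · exact hw i hlt (by omega)
    rw [hsplit, measure_iUnion]
    · simp only [ih]
      rw [ENNReal.tsum_prod']
      simp only [ENNReal.tsum_prod']
      simp only [← ENNReal.tsum_mul_left]
      refine tsum_congr fun b => tsum_congr fun a => tsum_congr fun t => ?_
      simp only [next, hμ.2, histProb, histProbAux_append, List.nil_append]
      ring
    · intro q q' hne
      refine Set.disjoint_left.2 fun ω hω hω' => hne ?_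
      have h1 := ((hmem q ω).1 hω.1).2
      have h2 := ((hmem q' ω).1 hω'.1).2
      have h3 := h1.1.symm.trans h2.1
      rw [Step.mk.injEq] at h3
      exact Prod.ext h3.2.2 (Prod.ext h3.2.1 (h1.2.symm.trans h2.2))
    · exact fun q => (measurableSet_cylinder _).inter (measurableSet_avoidWindow _ _ _)

/-- The probability of avoiding `bot` is the limit of the finite horizon probabilities. -/
lemma measure_avoids [Countable S] [Countable A] [Countable B]
    (G : Game S A B) (bot : S) {σ : Hist S A B → PMF A} {π : Hist S A B → PMF B} {s : S}
    {μ : Measure (Play S A B)} (hμ : G.IsPlayMeasure σ π s μ) :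
    μ (Avoids bot) = ⨅ n, G.avoidWithin bot σ π n ([], s) := by
  have := hμ.1
  have hcyl : μ (cylinder ([], s)) = 1 := by simp [hμ.2, histProb, histProbAux]
  have hinter : (Avoids bot : Set (Play S A B)) = ⋂ n, avoidWindow bot 0 n := by
    ext ω
    simp only [Avoids, avoidWindow, Set.mem_iInter, Set.mem_ofPred_eq]
    exact ⟨fun h _ i _ _ => h i, fun h i => h i i (Nat.zero_le _) (by simp)⟩
  have hanti : Antitone fun n => (avoidWindow bot 0 n : Set (Play S A B)) :=
    fun m n hmn ω hω i hi hi' => hω i hi (by omega)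
  rw [hinter, hanti.measure_iInter
    (fun n => (measurableSet_avoidWindow bot 0 n).nullMeasurableSet) ⟨0, measure_ne_top _ _⟩]
  refine iInf_congr fun n => ?_
  have key := G.measure_cylinder_inter_avoidWindow bot hμ n ([], s)
  rw [hcyl, one_mul] at key
  rw [← key, Set.inter_comm]
  refine (measure_inter_conull ?_).symm
  exact (prob_compl_eq_zero_iff (measurableSet_cylinder _)).2 hcyl

end Game

/-- if all Max action sets are finite, then Max has a single
memoryless strategy optimal for the safety objective from every state. -/
theorem stmt2 {S A B : Type} [Countable S] [Countable A] [Countable B]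
    (G : Game S A B) (hA : ∀ s, (G.actA s).Finite)
    (bot : S) (hbot : G.IsSink bot)
    (P : (Hist S A B → PMF A) → (Hist S A B → PMF B) → S →
      MeasureTheory.Measure (Play S A B))
    (hP : ∀ σ π s, G.IsMaxStrategy σ → G.IsMinStrategy π →
      G.IsPlayMeasure σ π s (P σ π s)) :
    ∃ σ, G.IsMaxStrategy σ ∧ Memoryless σ ∧
      ∀ s : S, ∀ π, G.IsMinStrategy π →
        G.val P (Avoids bot) s ≤ P σ π s (Avoids bot) := by
  choose α hα using fun s => G.exists_mixed_le_expE bot s (hA s)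
  have hmax : G.IsMaxStrategy fun h : Hist S A B => (α h.2 : PMF A) := fun h => (α h.2).2
  refine ⟨_, hmax, ?memoryless, fun s π hπ => ?_⟩
  case memoryless =>
    rintro ⟨_, s⟩ ⟨_, s'⟩ rfl
    rfl
  trans ⨅ n, G.safeVal bot n s
  · refine iSup₂_le fun τ hτ => le_iInf fun n => ENNReal.le_of_forall_pos_le_add ?_
    intro ε hε _
    obtain ⟨ρ, hρ, hle⟩ := G.exists_min_avoidWithin_le bot τ hτ n
      (ε := ε / (n + 1 : ℝ≥0∞)) (by simp [hε.ne', ENNReal.div_eq_zero_iff])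
    refine (iInf₂_le ρ hρ).trans ?_
    rw [G.measure_avoids bot (hP τ ρ s hτ hρ)]
    refine (iInf_le _ n).trans ((hle s).trans (add_le_add_right ?_ _))
    calc (n : ℝ≥0∞) * (ε / (n + 1)) ≤ (n + 1) * (ε / (n + 1)) := by gcongr; exact le_self_add
      _ = ε := ENNReal.mul_div_cancel (by simp) (by simp)
  · rw [G.measure_avoids bot (hP _ π s hmax hπ)]
    refine le_iInf fun n => ?_
    exact G.le_avoidWithin hπ (u := fun s => ⨅ n, G.safeVal bot n s)
      (fun s => (iInf_le _ 0).trans (G.safeVal_le_one bot 0 s))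
      (le_antisymm ((iInf_le _ 0).trans (by simp [Game.safeVal])) zero_le)
      (fun h b hb => hα h.2 b hb) n ([], s)
end

section
/- Let G be a concurrent stochastic game with countable state set S, a sink target state ⊤, countable Max action sets, and with B(s) finite for every s ∈ S. Then for every ε > 0 and every finite subset S_0 ⊆ S, Max has a memoryless strategy σ that is ε-optimal for Reach(⊤) from every s_0 ∈ S_0, and such that for every s ∈ S the support of the mixed action σ(s) is finite. -/
open scoped ENNReal Classical

namespace Game

variable {S A B : Type}

/-- The probability of visiting `top` within the next `n` steps after the history `(pre, cur)`. -/
noncomputable def reachProb (G : Game S A B) (σ : Hist S A B → PMF A) (π : Hist S A B → PMF B)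
    (top : S) : ℕ → List (Step S A B) → S → ℝ≥0∞
  | 0, _, cur => if cur = top then 1 else 0
  | n + 1, pre, cur =>
    if cur = top then 1
    else ∑' a, σ (pre, cur) a * ∑' b, π (pre, cur) b *
      expE (G.p cur a b) fun t => reachProb G σ π top n (pre ++ [⟨cur, a, b⟩]) t

theorem histProbAux_append_singleton (G : Game S A B) (σ : Hist S A B → PMF A)
    (π : Hist S A B → PMF B) (z : Step S A B) (t : S) (l pre : List (Step S A B)) (cur : S) :
    G.histProbAux σ π pre cur (l ++ [z]) t =
      G.histProbAux σ π pre cur l z.st *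
        (σ (pre ++ l, z.st) z.ac * π (pre ++ l, z.st) z.bc * G.p z.st z.ac z.bc t) := by
  induction l generalizing pre cur with
  | nil =>
    simp only [List.nil_append, histProbAux, nextState, List.append_nil]
    by_cases h : z.st = cur <;> simp [h]
  | cons w l ih =>
    have hn : nextState (l ++ [z]) t = nextState l z.st := by cases l <;> rfl
    simp only [List.cons_append, histProbAux, hn]
    split_ifs with h
    · rw [ih]
      simp only [List.append_assoc, List.cons_append, List.nil_append, mul_assoc]
    · simp

theorem histProb_append_singleton (G : Game S A B) (σ : Hist S A B → PMF A)
    (π : Hist S A B → PMF B) (s₀ : S) (l : List (Step S A B)) (z : Step S A B) (t : S) :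
    G.histProb σ π s₀ (l ++ [z], t) = G.histProb σ π s₀ (l, z.st) *
      (σ (l, z.st) z.ac * π (l, z.st) z.bc * G.p z.st z.ac z.bc t) := by
  simpa [histProb] using G.histProbAux_append_singleton σ π z t l [] s₀

end Game

section Cylinder

variable {S A B : Type}

theorem mem_cylinder_iff {l : List (Step S A B)} {s : S} {ω : Play S A B} :
    ω ∈ cylinder (l, s) ↔ (∀ i (hi : i < l.length), ω i = l[i]) ∧ (ω l.length).st = s :=
  ⟨fun h => ⟨fun i hi => h.1 ⟨i, hi⟩, h.2⟩, fun h => ⟨fun i => h.1 i i.2, h.2⟩⟩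

theorem mem_cylinder_append_singleton_iff {l : List (Step S A B)} {z : Step S A B} {t : S}
    {ω : Play S A B} :
    ω ∈ cylinder (l ++ [z], t) ↔
      ω ∈ cylinder (l, z.st) ∧ ω l.length = z ∧ (ω (l.length + 1)).st = t := by
  simp only [mem_cylinder_iff, List.length_append, List.length_singleton]
  constructor
  · rintro ⟨h, ht⟩
    have hz : ω l.length = z := by simpa using h l.length (by simp)
    refine ⟨⟨fun i hi => ?_, by rw [hz]⟩, hz, ht⟩
    rw [h i (by omega), List.getElem_append_left hi]
  · rintro ⟨⟨h, -⟩, hz, ht⟩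
    refine ⟨fun i hi => ?_, ht⟩
    rcases Nat.lt_or_ge i l.length with hl | hl
    · rw [h i hl, List.getElem_append_left hl]
    · obtain rfl : i = l.length := by omega
      simpa using hz

theorem measurableSet_coord (i : ℕ) (T : Set (Step S A B)) :
    MeasurableSet {ω : Play S A B | ω i ∈ T} :=
  measurable_pi_apply (X := fun _ : ℕ => Step S A B) i (MeasurableSpace.measurableSet_top (s := T))

theorem measurableSet_cylinder (h : Hist S A B) : MeasurableSet (cylinder h) := by
  have : cylinder h = (⋂ i : Fin h.1.length, {ω : Play S A B | ω i ∈ ({h.1.get i} : Set _)}) ∩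
      {ω : Play S A B | ω h.1.length ∈ {z : Step S A B | z.st = h.2}} := by
    ext ω
    simp [cylinder]
  rw [this]
  exact (MeasurableSet.iInter fun i => measurableSet_coord _ _).inter (measurableSet_coord _ _)

/-- The event that the play visits `top` between times `k` and `k + n`. -/
def ReachesBetween (top : S) (k n : ℕ) : Set (Play S A B) := {ω | ∃ i ≤ n, (ω (k + i)).st = top}

theorem measurableSet_reachesBetween (top : S) (k n : ℕ) :
    MeasurableSet (ReachesBetween top k n : Set (Play S A B)) := by
  have : (ReachesBetween top k n : Set (Play S A B)) =
      ⋃ i : ℕ, ⋃ _ : i ≤ n, {ω : Play S A B | ω (k + i) ∈ {z : Step S A B | z.st = top}} := by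
    ext ω
    simp [ReachesBetween]
  rw [this]
  exact MeasurableSet.iUnion fun i => MeasurableSet.iUnion fun _ => measurableSet_coord _ _

theorem cylinder_inter_reachesBetween_succ {top s : S} (hs : s ≠ top) (l : List (Step S A B))
    (n : ℕ) :
    cylinder (l, s) ∩ ReachesBetween top l.length (n + 1) =
      ⋃ x : A × B × S, cylinder (l ++ [(⟨s, x.1, x.2.1⟩ : Step S A B)], x.2.2) ∩
        ReachesBetween top (l.length + 1) n := by
  ext ω
  simp only [Set.mem_inter_iff, Set.mem_iUnion, mem_cylinder_append_singleton_iff]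
  constructor
  · rintro ⟨h, i, hi, ht⟩
    have hst : (ω l.length).st = s := (mem_cylinder_iff.1 h).2
    refine ⟨((ω l.length).ac, (ω l.length).bc, (ω (l.length + 1)).st), ⟨h, ?_, rfl⟩, ?_⟩
    · rw [← hst]
    · rcases i with _ | i
      · exact absurd (hst.symm.trans ht) hs
      · exact ⟨i, by omega, by rw [← ht]; congr 2; omega⟩
  · rintro ⟨x, ⟨h, -, -⟩, i, hi, ht⟩
    exact ⟨h, i + 1, by omega, by rw [← ht]; congr 2; omega⟩

end Cylinder

namespace Game

variable {S A B : Type}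

theorem measure_cylinder_inter_reachesBetween [Countable S] [Countable A] [Countable B]
    (G : Game S A B) {σ : Hist S A B → PMF A} {π : Hist S A B → PMF B} {s₀ : S}
    {μ : MeasureTheory.Measure (Play S A B)} (hμ : G.IsPlayMeasure σ π s₀ μ) (top : S) (n : ℕ)
    (l : List (Step S A B)) (s : S) :
    μ (cylinder (l, s) ∩ ReachesBetween top l.length n) =
      G.histProb σ π s₀ (l, s) * G.reachProb σ π top n l s := by
  have of_eq_top : ∀ n, s = top →
      μ (cylinder (l, s) ∩ ReachesBetween top l.length n) = G.histProb σ π s₀ (l, s) := by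
    intro n hs
    rw [Set.inter_eq_left.2, hμ.2]
    exact fun ω hω => ⟨0, by omega, (mem_cylinder_iff.1 hω).2.trans hs⟩
  induction n generalizing l s with
  | zero =>
    by_cases hs : s = top
    · rw [of_eq_top 0 hs, reachProb, if_pos hs, mul_one]
    · rw [reachProb, if_neg hs, mul_zero]
      convert MeasureTheory.measure_empty (μ := μ)
      ext ω
      simp only [Set.mem_inter_iff, Set.mem_empty_iff_false, iff_false, not_and]
      rintro h ⟨i, hi, ht⟩
      obtain rfl : i = 0 := by omega
      exact hs ((mem_cylinder_iff.1 h).2.symm.trans ht)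
  | succ n ih =>
    by_cases hs : s = top
    · rw [of_eq_top (n + 1) hs, reachProb, if_pos hs, mul_one]
    · rw [cylinder_inter_reachesBetween_succ hs, MeasureTheory.measure_iUnion, reachProb,
        if_neg hs, ENNReal.tsum_prod', ← ENNReal.tsum_mul_left]
      · refine tsum_congr fun a => ?_
        rw [ENNReal.tsum_prod', ← ENNReal.tsum_mul_left, ← ENNReal.tsum_mul_left]
        refine tsum_congr fun b => ?_
        rw [expE, ← ENNReal.tsum_mul_left, ← ENNReal.tsum_mul_left, ← ENNReal.tsum_mul_left]
        refine tsum_congr fun t => ?_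
        have := ih (l ++ [⟨s, a, b⟩]) t fun m ht => by
          rw [Set.inter_eq_left.2, hμ.2]
          exact fun ω hω => ⟨0, by omega, (mem_cylinder_iff.1 hω).2.trans ht⟩
        rw [List.length_append, List.length_singleton] at this
        rw [this, histProb_append_singleton]
        ring
      · rintro ⟨a, b, t⟩ ⟨a', b', t'⟩ hne
        refine Set.disjoint_left.2 fun ω h h' => hne ?_
        obtain ⟨-, h1, h2⟩ := mem_cylinder_append_singleton_iff.1 h.1
        obtain ⟨-, h1', h2'⟩ := mem_cylinder_append_singleton_iff.1 h'.1
        have := h1.symm.trans h1'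
        simp only [Step.mk.injEq, true_and] at this
        exact Prod.ext this.1 (Prod.ext this.2 (h2.symm.trans h2'))
      · exact fun x => (measurableSet_cylinder _).inter (measurableSet_reachesBetween _ _ _)

theorem IsPlayMeasure.reaches_eq_iSup [Countable S] [Countable A] [Countable B]
    {G : Game S A B} {σ : Hist S A B → PMF A} {π : Hist S A B → PMF B} {s₀ : S}
    {μ : MeasureTheory.Measure (Play S A B)} (hμ : G.IsPlayMeasure σ π s₀ μ) (top : S) :
    μ (Reaches top) = ⨆ n, G.reachProb σ π top n [] s₀ := by
  have := hμ.1
  have hunion : (Reaches top : Set (Play S A B)) = ⋃ n, ReachesBetween top 0 n := by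
    ext ω
    simp only [Reaches, ReachesBetween, Set.mem_iUnion, zero_add]
    exact ⟨fun ⟨i, hi⟩ => ⟨i, i, le_rfl, hi⟩, fun ⟨_, i, _, hi⟩ => ⟨i, hi⟩⟩
  have hmono : Monotone fun n => (ReachesBetween top 0 n : Set (Play S A B)) :=
    fun m n hmn ω ⟨i, hi, ht⟩ => ⟨i, hi.trans hmn, ht⟩
  rw [hunion, hmono.measure_iUnion]
  refine iSup_congr fun n => ?_
  have h0 : G.histProb σ π s₀ ([], s₀) = 1 := by simp [histProb, histProbAux]
  have hcyl : μ (cylinder ([], s₀)) = 1 := by rw [hμ.2, h0]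
  have hae : μ (cylinder ([], s₀))ᶜ = 0 :=
    (MeasureTheory.prob_compl_eq_zero_iff (measurableSet_cylinder _)).2 hcyl
  have h := G.measure_cylinder_inter_reachesBetween hμ top n [] s₀
  rw [h0, one_mul] at h
  rw [← h, Set.inter_comm, MeasureTheory.measure_inter_conull hae]
  rfl

end Game

section Expectation

variable {S A : Type}

theorem expE_mono (μ : PMF S) {v w : S → ℝ≥0∞} (h : ∀ s, v s ≤ w s) : expE μ v ≤ expE μ w :=
  ENNReal.tsum_le_tsum fun s => mul_le_mul_right (h s) _

theorem expE_const (μ : PMF S) (c : ℝ≥0∞) : expE μ (fun _ => c) = c := by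
  rw [expE, ENNReal.tsum_mul_right, μ.tsum_coe, one_mul]

theorem expE_const_mul (μ : PMF S) (c : ℝ≥0∞) (v : S → ℝ≥0∞) :
    expE μ (fun s => c * v s) = c * expE μ v := by
  simp_rw [expE, ← ENNReal.tsum_mul_left, mul_left_comm]

theorem expE_add (μ : PMF S) (v w : S → ℝ≥0∞) :
    expE μ (fun s => v s + w s) = expE μ v + expE μ w := by
  simp_rw [expE, mul_add, ENNReal.tsum_add]

theorem expE_bind (μ : PMF A) (κ : A → PMF S) (v : S → ℝ≥0∞) :
    expE (μ.bind κ) v = ∑' a, μ a * expE (κ a) v := by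
  simp_rw [expE, PMF.bind_apply, ← ENNReal.tsum_mul_right, ← ENNReal.tsum_mul_left]
  rw [ENNReal.tsum_comm]
  simp_rw [mul_assoc]

theorem expE_map (μ : PMF A) (f : A → S) (v : S → ℝ≥0∞) :
    expE (μ.map f) v = ∑' a, μ a * v (f a) := by
  have (s : S) : expE (PMF.pure s) v = v s := by
    rw [expE, tsum_eq_single s fun t ht => by simp [ht]]
    simp
  rw [PMF.map, expE_bind]
  simp only [Function.comp_apply, this]

theorem expE_le_one (μ : PMF S) {v : S → ℝ≥0∞} (hv : ∀ s, v s ≤ 1) : expE μ v ≤ 1 :=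
  (expE_mono μ hv).trans (expE_const μ 1).le

theorem expE_iSup (μ : PMF S) {v : ℕ → S → ℝ≥0∞} (hv : Monotone v) :
    expE μ (fun s => ⨆ n, v n s) = ⨆ n, expE μ (v n) := by
  simp_rw [expE, ENNReal.mul_iSup]
  let : MeasurableSpace S := ⊤
  simp_rw [← MeasureTheory.lintegral_count]
  exact MeasureTheory.lintegral_iSup (fun _ => measurable_from_top)
    fun m n hmn s => mul_le_mul_right (hv hmn s) _

theorem tsum_mul_le_of_forall_mem (μ : PMF A) {f : A → ℝ≥0∞} {c : ℝ≥0∞} {T : Set A}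
    (hμ : μ.support ⊆ T) (h : ∀ a ∈ T, f a ≤ c) : ∑' a, μ a * f a ≤ c := by
  calc ∑' a, μ a * f a ≤ ∑' a, μ a * c := by
        refine ENNReal.tsum_le_tsum fun a => ?_
        by_cases ha : μ a = 0
        · simp [ha]
        · exact mul_le_mul_right (h a (hμ ((PMF.mem_support_iff _ _).2 ha))) _
    _ = c := by rw [ENNReal.tsum_mul_right, μ.tsum_coe, one_mul]

theorem le_tsum_mul_of_forall_mem (μ : PMF A) {f : A → ℝ≥0∞} {c : ℝ≥0∞} {T : Set A}
    (hμ : μ.support ⊆ T) (h : ∀ a ∈ T, c ≤ f a) : c ≤ ∑' a, μ a * f a := by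
  calc c = ∑' a, μ a * c := by rw [ENNReal.tsum_mul_right, μ.tsum_coe, one_mul]
    _ ≤ ∑' a, μ a * f a := by
        refine ENNReal.tsum_le_tsum fun a => ?_
        by_cases ha : μ a = 0
        · simp [ha]
        · exact mul_le_mul_right (h a (hμ ((PMF.mem_support_iff _ _).2 ha))) _

end Expectation

section MatrixGame

/-- The hard direction of the minimax theorem for a matrix game in which the minimizer has
finitely many actions. -/
theorem exists_stdSimplex_forall_sum_mul_le {I J : Type} [Fintype J] [Nonempty J]
    (f : I → J → ℝ) (c : ℝ) (h : ∀ x ∈ convexHull ℝ (Set.range f), ∃ j, x j ≤ c) :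
    ∃ w ∈ stdSimplex ℝ J, ∀ i, ∑ j, w j * f i j ≤ c := by
  have hK : IsOpen {x : J → ℝ | ∀ j, c < x j} := by
    have : {x : J → ℝ | ∀ j, c < x j} = ⋂ j, {x : J → ℝ | c < x j} := by ext; simp
    rw [this]
    exact isOpen_iInter_of_finite fun j => isOpen_lt continuous_const (continuous_apply j)
  have hKc : Convex ℝ {x : J → ℝ | ∀ j, c < x j} := by
    intro x hx y hy a b ha hb hab j
    have hmin : c < min (x j) (y j) := lt_min (hx j) (hy j)
    calc c < min (x j) (y j) := hmin
      _ = a * min (x j) (y j) + b * min (x j) (y j) := by rw [← add_mul, hab, one_mul]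
      _ ≤ a * x j + b * y j := add_le_add
          (mul_le_mul_of_nonneg_left (min_le_left _ _) ha)
          (mul_le_mul_of_nonneg_left (min_le_right _ _) hb)
  have hdisj : Disjoint (convexHull ℝ (Set.range f)) {x : J → ℝ | ∀ j, c < x j} :=
    Set.disjoint_left.2 fun x hx hx' =>
      let ⟨j, hj⟩ := h x hx
      absurd hj (not_le.2 (hx' j))
  rcases isEmpty_or_nonempty I with hI | ⟨⟨i₀⟩⟩
  · obtain ⟨j⟩ := ‹Nonempty J›
    exact ⟨Pi.single j 1, single_mem_stdSimplex ℝ j, fun i => (IsEmpty.false i).elim⟩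
  obtain ⟨φ, r, hφ, hφK⟩ := geometric_hahn_banach_open hKc hK (convex_convexHull ℝ _) hdisj.symm
  set w : J → ℝ := fun j => -φ (Pi.single j 1) with hw
  have hφx : ∀ x : J → ℝ, φ x = -∑ j, w j * x j := by
    intro x
    conv_lhs => rw [pi_eq_sum_univ' x]
    rw [map_sum, ← Finset.sum_neg_distrib]
    refine Finset.sum_congr rfl fun j _ => ?_
    rw [map_smul, smul_eq_mul, hw]
    ring
  have hmem : ∀ i, r ≤ φ (f i) := fun i => hφK _ (subset_convexHull ℝ _ ⟨i, rfl⟩)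
  have hwnn : ∀ j, 0 ≤ w j := by
    intro j
    by_contra! hj
    set M : ℝ := ∑ k, w k * (c + 1) with hM
    obtain ⟨t, ht0, ht⟩ : ∃ t : ℝ, 0 ≤ t ∧ r ≤ -M - w j * t := by
      refine ⟨(|r| + |M|) / (-w j), by
        have : 0 < -w j := by linarith
        positivity, ?_⟩
      have : w j * ((|r| + |M|) / (-w j)) = -(|r| + |M|) := by
        rw [div_neg, mul_neg, mul_div_cancel₀ _ hj.ne]
      rw [this]
      linarith [le_abs_self r, le_abs_self M]
    have := hφ (fun k => c + 1 + if k = j then t else 0) fun k => by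
      dsimp only
      split_ifs <;> linarith
    rw [hφx] at this
    simp only [mul_add, mul_ite, mul_zero, Finset.sum_add_distrib, Finset.sum_ite_eq',
      Finset.mem_univ, if_true] at this
    simp only [hM, mul_add, Finset.sum_add_distrib] at ht
    linarith
  have hconst : ∀ e : ℝ, 0 < e → -((∑ j, w j) * (c + e)) < r := by
    intro e he
    have := hφ (fun _ => c + e) fun _ => by linarith
    rwa [hφx, ← Finset.sum_mul] at this
  have hsum : 0 < ∑ j, w j := by
    refine lt_of_le_of_ne (Finset.sum_nonneg fun j _ => hwnn j) fun h0 => ?_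
    have hz : ∀ j, w j = 0 := fun j =>
      (Finset.sum_eq_zero_iff_of_nonneg fun j _ => hwnn j).1 h0.symm j (Finset.mem_univ j)
    have h1 := hconst 1 one_pos
    have h2 := hmem i₀
    rw [hφx] at h2
    simp only [hz, zero_mul, Finset.sum_const_zero, neg_zero] at h1 h2
    linarith
  refine ⟨fun j => w j / ∑ k, w k, ⟨fun j => div_nonneg (hwnn j) hsum.le, ?_⟩, fun i => ?_⟩
  · rw [← Finset.sum_div, div_self hsum.ne']
  · simp_rw [div_mul_eq_mul_div]
    rw [← Finset.sum_div, div_le_iff₀ hsum]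
    have h1 := hmem i
    rw [hφx] at h1
    refine le_of_forall_pos_le_add fun e he => ?_
    have h2 := hconst (e / ∑ j, w j) (by positivity)
    rw [mul_add, mul_div_cancel₀ _ hsum.ne'] at h2
    linarith

end MatrixGame

namespace Game

variable {S A B : Type}

/-- The lower value of the one-shot game at `s` with payoff `w`, where Max is restricted to
finitely supported mixed actions. -/
noncomputable def oneStepVal (G : Game S A B) (s : S) (w : S → ℝ≥0∞) : ℝ≥0∞ :=
  ⨆ α ∈ {α : PMF A | α.support ⊆ G.actA s ∧ α.support.Finite}, ⨅ b ∈ G.actB s, expE (G.pA s α b) w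

theorem oneStepVal_mono (G : Game S A B) (s : S) {v w : S → ℝ≥0∞} (h : ∀ t, v t ≤ w t) :
    G.oneStepVal s v ≤ G.oneStepVal s w :=
  iSup₂_mono fun _ _ => iInf₂_mono fun _ _ => expE_mono _ h

theorem mul_oneStepVal_le (G : Game S A B) (s : S) (c : ℝ≥0∞) (v : S → ℝ≥0∞) :
    c * G.oneStepVal s v ≤ G.oneStepVal s fun t => c * v t := by
  simp_rw [oneStepVal, ENNReal.mul_iSup]
  refine iSup₂_mono fun α _ => le_iInf₂ fun b hb => ?_
  rw [expE_const_mul]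
  exact mul_le_mul_right (iInf₂_le b hb) _

theorem oneStepVal_le_one (G : Game S A B) (s : S) {v : S → ℝ≥0∞} (hv : ∀ t, v t ≤ 1) :
    G.oneStepVal s v ≤ 1 := by
  obtain ⟨b, hb⟩ := G.actB_nonempty s
  exact iSup₂_le fun α _ => (iInf₂_le b hb).trans (expE_le_one _ hv)

theorem oneStepVal_iSup (G : Game S A B) {s : S} (hB : (G.actB s).Finite) {v : ℕ → S → ℝ≥0∞}
    (hv : Monotone v) : G.oneStepVal s (fun t => ⨆ n, v n t) = ⨆ n, G.oneStepVal s (v n) := by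
  have := fun α : PMF A => hB.iSup_biInf_of_monotone (f := fun b n => expE (G.pA s α b) (v n))
    fun b _ m n hmn => expE_mono _ (hv hmn)
  simp_rw [oneStepVal, expE_iSup _ hv, ← this]
  rw [iSup_comm]
  exact iSup_congr fun α => iSup_comm

/-- Against a one-shot game of value at most `c`, Min has a mixed action guaranteeing `c`. -/
theorem exists_minAction_of_oneStepVal_le (G : Game S A B) {s : S} (hB : (G.actB s).Finite)
    {v : S → ℝ≥0∞} (hv : ∀ t, v t ≤ 1) {c : ℝ≥0∞} (hc : c ≠ ∞) (h : G.oneStepVal s v ≤ c) :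
    ∃ β : PMF B, β.support ⊆ G.actB s ∧
      ∀ a ∈ G.actA s, ∑' b, β b * expE (G.p s a b) v ≤ c := by
  have := hB.fintype
  have := (G.actB_nonempty s).to_subtype
  have hfin : ∀ μ : PMF S, expE μ v ≠ ∞ := fun μ =>
    ((expE_le_one μ hv).trans_lt ENNReal.one_lt_top).ne
  obtain ⟨w, ⟨hw0, hw1⟩, hw⟩ := exists_stdSimplex_forall_sum_mul_le
    (fun (a : G.actA s) (b : G.actB s) => (expE (G.p s a b) v).toReal) c.toReal <| by
      intro x hx
      obtain ⟨ι, _, u, z, hu0, hu1, hz, rfl⟩ := mem_convexHull_iff_exists_fintype.1 hx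
      choose a ha using hz
      have hu1' : ∑ i, ENNReal.ofReal (u i) = 1 := by
        rw [← ENNReal.ofReal_sum_of_nonneg fun i _ => hu0 i, hu1, ENNReal.ofReal_one]
      set α : PMF A := (PMF.ofFintype _ hu1').map fun i => (a i : A) with hα
      have hsupp : α.support ⊆ Set.range fun i => (a i : A) := by
        rw [hα, PMF.support_map]
        exact Set.image_subset_range _ _
      have hexp : ∀ b, expE (G.pA s α b) v =
          ∑ i, ENNReal.ofReal (u i) * expE (G.p s (a i) b) v := by
        intro b
        have := expE_map (PMF.ofFintype _ hu1') (fun i => (a i : A)) fun a' => expE (G.p s a' b) v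
        rw [pA, expE_bind, ← expE, hα, this, tsum_fintype]
        rfl
      have hle : ⨅ b : G.actB s, expE (G.pA s α b) v ≤ c := by
        rw [iInf_subtype]
        refine le_trans ?_ h
        refine le_iSup₂ (f := fun α (_ : α ∈ {α : PMF A | α.support ⊆ G.actA s ∧
          α.support.Finite}) => ⨅ b ∈ G.actB s, expE (G.pA s α b) v) α ⟨?_, ?_⟩
        · rintro _ h'
          obtain ⟨i, rfl⟩ := hsupp h'
          exact (a i).2
        · exact (Set.finite_range _).subset hsupp
      obtain ⟨b, hb⟩ := exists_eq_ciInf_of_finite (f := fun b : G.actB s => expE (G.pA s α b) v)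
      rw [← hb] at hle
      refine ⟨b, ?_⟩
      rw [hexp] at hle
      have := ENNReal.toReal_mono hc hle
      rw [ENNReal.toReal_sum fun i _ => ENNReal.mul_ne_top ENNReal.ofReal_ne_top (hfin _)] at this
      simp only [ENNReal.toReal_mul, ENNReal.toReal_ofReal (hu0 _)] at this
      simpa [← ha] using this
  have hw1' : ∑ b, ENNReal.ofReal (w b) = 1 := by
    rw [← ENNReal.ofReal_sum_of_nonneg fun i _ => hw0 i, hw1, ENNReal.ofReal_one]
  refine ⟨(PMF.ofFintype _ hw1').map Subtype.val, ?_, fun a ha => ?_⟩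
  · rw [PMF.support_map]
    rintro _ ⟨b, -, rfl⟩
    exact b.2
  · have := expE_map (PMF.ofFintype _ hw1') Subtype.val fun b => expE (G.p s a b) v
    rw [← expE, this, tsum_fintype]
    refine (ENNReal.toReal_le_toReal (ENNReal.sum_ne_top.2 fun b _ =>
      ENNReal.mul_ne_top ENNReal.ofReal_ne_top (hfin _)) hc).1 ?_
    rw [ENNReal.toReal_sum fun i _ => ENNReal.mul_ne_top ENNReal.ofReal_ne_top (hfin _)]
    simpa [ENNReal.toReal_mul, ENNReal.toReal_ofReal (hw0 _)] using hw ⟨a, ha⟩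

/-- The value of reaching `top` within `n` steps, defined by backward induction. -/
noncomputable def stepVal (G : Game S A B) (top : S) : ℕ → S → ℝ≥0∞
  | 0, s => if s = top then 1 else 0
  | n + 1, s => if s = top then 1 else G.oneStepVal s (stepVal G top n)

theorem stepVal_top (G : Game S A B) (top : S) (n : ℕ) : G.stepVal top n top = 1 := by
  cases n <;> simp [stepVal]

theorem stepVal_le_one (G : Game S A B) (top : S) (n : ℕ) (s : S) : G.stepVal top n s ≤ 1 := by
  induction n generalizing s with
  | zero => rw [stepVal]; split_ifs <;> simp
  | succ n ih =>
    rw [stepVal]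
    split_ifs
    · exact le_rfl
    · exact G.oneStepVal_le_one s ih

theorem stepVal_monotone (G : Game S A B) (top : S) : Monotone (G.stepVal top) := by
  refine monotone_nat_of_le_succ fun n => ?_
  induction n with
  | zero =>
    intro s
    rw [stepVal, stepVal]
    split_ifs <;> simp
  | succ n ih =>
    intro s
    rw [stepVal, stepVal]
    split_ifs
    · exact le_rfl
    · exact G.oneStepVal_mono s ih

/-- The limit of the finite-horizon values. -/
noncomputable def limVal (G : Game S A B) (top s : S) : ℝ≥0∞ := ⨆ n, G.stepVal top n s

theorem limVal_le_one (G : Game S A B) (top s : S) : G.limVal top s ≤ 1 :=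
  iSup_le fun n => G.stepVal_le_one top n s

theorem oneStepVal_limVal_le (G : Game S A B) {top s : S} (hB : (G.actB s).Finite)
    (hs : s ≠ top) : G.oneStepVal s (G.limVal top) ≤ G.limVal top s := by
  have := G.oneStepVal_iSup hB (G.stepVal_monotone top)
  refine this.trans_le (iSup_le fun n => le_iSup_of_le (n + 1) ?_)
  rw [stepVal, if_neg hs]

theorem exists_minStrategy_reachProb_le (G : Game S A B) (hB : ∀ s, (G.actB s).Finite) (top : S) :
    ∃ π : Hist S A B → PMF B, G.IsMinStrategy π ∧ ∀ σ, G.IsMaxStrategy σ →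
      ∀ n pre s, G.reachProb σ π top n pre s ≤ G.limVal top s := by
  have hβ : ∀ s, ∃ β : PMF B, β.support ⊆ G.actB s ∧ (s ≠ top → ∀ a ∈ G.actA s,
      ∑' b, β b * expE (G.p s a b) (G.limVal top) ≤ G.limVal top s) := by
    intro s
    by_cases hs : s = top
    · obtain ⟨b, hb⟩ := G.actB_nonempty s
      exact ⟨PMF.pure b, by simpa using hb, fun h => absurd hs h⟩
    · obtain ⟨β, h, h'⟩ := G.exists_minAction_of_oneStepVal_le (hB s) (G.limVal_le_one top)
        ((G.limVal_le_one top s).trans_lt ENNReal.one_lt_top).ne (G.oneStepVal_limVal_le (hB s) hs)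
      exact ⟨β, h, fun _ => h'⟩
  choose β hβ hβ' using hβ
  refine ⟨fun h => β h.2, fun h => hβ h.2, fun σ hσ n => ?_⟩
  have of_top : 1 ≤ G.limVal top top := le_iSup_of_le 0 (G.stepVal_top top 0).ge
  induction n with
  | zero =>
    intro pre s
    rw [reachProb]
    split_ifs with hs
    · rwa [hs]
    · exact zero_le
  | succ n ih =>
    intro pre s
    rw [reachProb]
    split_ifs with hs
    · rwa [hs]
    · exact tsum_mul_le_of_forall_mem _ (hσ _) fun a ha =>
        (ENNReal.tsum_le_tsum fun b => mul_le_mul_right (expE_mono _ fun t => ih _ t) _).trans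
          (hβ' s hs a ha)

theorem val_le_limVal [Countable S] [Countable A] [Countable B] (G : Game S A B)
    (hB : ∀ s, (G.actB s).Finite)
    (P : (Hist S A B → PMF A) → (Hist S A B → PMF B) → S → MeasureTheory.Measure (Play S A B))
    (hP : ∀ σ π s, G.IsMaxStrategy σ → G.IsMinStrategy π → G.IsPlayMeasure σ π s (P σ π s))
    (top s : S) : G.val P (Reaches top) s ≤ G.limVal top s := by
  obtain ⟨π, hπ, h⟩ := G.exists_minStrategy_reachProb_le hB top
  refine iSup₂_le fun σ hσ => (iInf₂_le π hπ).trans ?_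
  rw [(hP σ π s hσ hπ).reaches_eq_iSup]
  exact iSup_le fun n => h σ hσ n [] s

/-- The supremum of the finite-horizon values discounted by the factor `c` per step. -/
noncomputable def discVal (G : Game S A B) (c : ℝ≥0∞) (top s : S) : ℝ≥0∞ :=
  ⨆ n : ℕ, c ^ n * G.stepVal top n s

theorem discVal_le_one (G : Game S A B) {c : ℝ≥0∞} (hc : c ≤ 1) (top s : S) :
    G.discVal c top s ≤ 1 :=
  iSup_le fun n => mul_le_one' (pow_le_one₀ zero_le hc) (G.stepVal_le_one top n s)

theorem discVal_le_mul_oneStepVal (G : Game S A B) (c : ℝ≥0∞) {top s : S} (hs : s ≠ top) :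
    G.discVal c top s ≤ c * G.oneStepVal s (G.discVal c top) := by
  refine iSup_le fun n => ?_
  rcases n with _ | n
  · simp [stepVal, hs]
  · rw [stepVal, if_neg hs, pow_succ', mul_assoc]
    refine mul_le_mul_right ((G.mul_oneStepVal_le s _ _).trans (G.oneStepVal_mono s fun t => ?_)) _
    exact le_iSup (fun n : ℕ => c ^ n * G.stepVal top n t) n

theorem exists_maxAction (G : Game S A B) {c d : ℝ≥0∞} (hcd : c < d) (hd : d ≤ 1) {top s : S}
    (hs : s ≠ top) :
    ∃ α : PMF A, α.support ⊆ G.actA s ∧ α.support.Finite ∧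
      ∀ b ∈ G.actB s, G.discVal c top s ≤ d * expE (G.pA s α b) (G.discVal c top) := by
  by_cases h0 : G.discVal c top s = 0
  · obtain ⟨a, ha⟩ := G.actA_nonempty s
    exact ⟨PMF.pure a, by simpa using ha, by simp, fun b _ => by simp [h0]⟩
  have hc1 : c < 1 := hcd.trans_le hd
  have h1 := G.discVal_le_mul_oneStepVal c hs
  have hV0 : G.oneStepVal s (G.discVal c top) ≠ 0 := fun h => h0 (by simpa [h] using h1)
  have hV1 : G.oneStepVal s (G.discVal c top) ≠ ∞ :=
    ((G.oneStepVal_le_one s (G.discVal_le_one hc1.le top)).trans_lt ENNReal.one_lt_top).ne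
  have hlt : G.discVal c top s < d * G.oneStepVal s (G.discVal c top) :=
    h1.trans_lt (ENNReal.mul_lt_mul_left hV0 hV1 hcd)
  simp_rw [oneStepVal, ENNReal.mul_iSup, lt_iSup_iff] at hlt
  obtain ⟨α, hα, h⟩ := hlt
  exact ⟨α, hα.1, hα.2, fun b hb => h.le.trans (mul_le_mul_right (iInf₂_le b hb) _)⟩

theorem exists_memoryless_discVal_le (G : Game S A B) {c : ℝ≥0∞} (hc : c < 1) (top : S) :
    ∃ σ : Hist S A B → PMF A, G.IsMaxStrategy σ ∧ Memoryless σ ∧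
      (∀ s, (σ ([], s)).support.Finite) ∧ ∀ π, G.IsMinStrategy π →
        ∀ pre s, G.discVal c top s ≤ ⨆ n, G.reachProb σ π top n pre s := by
  obtain ⟨d, hcd, hd⟩ := exists_between hc
  have hα : ∀ s, ∃ α : PMF A, α.support ⊆ G.actA s ∧ α.support.Finite ∧ (s ≠ top →
      ∀ b ∈ G.actB s, G.discVal c top s ≤ d * expE (G.pA s α b) (G.discVal c top)) := by
    intro s
    by_cases hs : s = top
    · obtain ⟨a, ha⟩ := G.actA_nonempty s
      exact ⟨PMF.pure a, by simpa using ha, by simp, fun h => absurd hs h⟩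
    · obtain ⟨α, h, h', h''⟩ := G.exists_maxAction hcd hd.le hs
      exact ⟨α, h, h', fun _ => h''⟩
  choose α hα hα' hα'' using hα
  refine ⟨fun h => α h.2, fun h => hα h.2, fun h h' e => by simp only [e], hα', ?_⟩
  intro π hπ
  have key : ∀ n pre s, G.discVal c top s ≤
      G.reachProb (fun h => α h.2) π top n pre s + d ^ n := by
    intro n
    induction n with
    | zero =>
      intro pre s
      rw [pow_zero]
      exact (G.discVal_le_one hc.le top s).trans le_add_self
    | succ n ih =>
      intro pre s
      rw [reachProb]
      split_ifs with hs
      · exact (G.discVal_le_one hc.le top s).trans le_self_add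
      set R : A → B → S → ℝ≥0∞ := fun a b t =>
        G.reachProb (fun h => α h.2) π top n (pre ++ [⟨s, a, b⟩]) t with hR
      calc G.discVal c top s
          ≤ ∑' b, π (pre, s) b * (d * expE (G.pA s (α s) b) (G.discVal c top)) :=
            le_tsum_mul_of_forall_mem _ (hπ (pre, s)) (hα'' s hs)
        _ = d * ∑' b, π (pre, s) b * ∑' a, α s a * expE (G.p s a b) (G.discVal c top) := by
            rw [← ENNReal.tsum_mul_left]
            refine tsum_congr fun b => ?_
            rw [pA, expE_bind, mul_left_comm]
        _ ≤ d * ∑' b, π (pre, s) b * ∑' a, α s a * (expE (G.p s a b) (R a b) + d ^ n) := by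
            gcongr with b a
            refine (expE_mono _ fun t => ih (pre ++ [⟨s, a, b⟩]) t).trans_eq ?_
            rw [expE_add, expE_const]
        _ = d * (∑' b, π (pre, s) b * ∑' a, α s a * expE (G.p s a b) (R a b)) + d ^ (n + 1) := by
            simp_rw [mul_add, ENNReal.tsum_add, ENNReal.tsum_mul_right, PMF.tsum_coe, one_mul,
              mul_add, ENNReal.tsum_add, ENNReal.tsum_mul_right, PMF.tsum_coe, one_mul, pow_succ',
              mul_add]
        _ ≤ (∑' b, π (pre, s) b * ∑' a, α s a * expE (G.p s a b) (R a b)) + d ^ (n + 1) := by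
            gcongr
            exact mul_le_of_le_one_left zero_le hd.le
        _ = _ := by
            congr 1
            simp_rw [← ENNReal.tsum_mul_left]
            rw [ENNReal.tsum_comm]
            simp_rw [mul_left_comm, hR]
  intro pre s
  have hlim := (ENNReal.tendsto_pow_atTop_nhds_zero_of_lt_one hd).const_add
    (⨆ n, G.reachProb (fun h => α h.2) π top n pre s)
  rw [add_zero] at hlim
  refine ge_of_tendsto' hlim fun n => (key n pre s).trans ?_
  gcongr
  exact le_iSup (fun n => G.reachProb (fun h => α h.2) π top n pre s) n

theorem exists_lt_one_limVal_sub_le_discVal (G : Game S A B) (top : S) {ε : ℝ≥0∞} (hε : 0 < ε)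
    {S₀ : Set S} (hS₀ : S₀.Finite) :
    ∃ c < 1, ∀ s ∈ S₀, G.limVal top s - ε ≤ G.discVal c top s := by
  have hev : ∀ s ∈ S₀, ∀ᶠ c in nhdsWithin (1 : ℝ≥0∞) (Set.Iio 1),
      G.limVal top s - ε ≤ G.discVal c top s := by
    intro s _
    by_cases h0 : G.limVal top s - ε = 0
    · exact Filter.Eventually.of_forall fun c => by simp [h0]
    have hlt : G.limVal top s - ε < G.limVal top s :=
      ENNReal.sub_lt_self ((G.limVal_le_one top s).trans_lt ENNReal.one_lt_top).ne
        (fun h => h0 (by simp [h])) hε.ne'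
    obtain ⟨n, hn⟩ := lt_iSup_iff.1 hlt
    have ht : Filter.Tendsto (fun c : ℝ≥0∞ => c ^ n * G.stepVal top n s)
        (nhdsWithin 1 (Set.Iio 1)) (nhds (1 ^ n * G.stepVal top n s)) := by
      refine Filter.Tendsto.mono_left ?_ nhdsWithin_le_nhds
      exact ENNReal.Tendsto.mul_const (ENNReal.continuous_pow n).continuousAt
        (Or.inr ((G.stepVal_le_one top n s).trans_lt ENNReal.one_lt_top).ne)
    rw [one_pow, one_mul] at ht
    filter_upwards [ht.eventually_const_lt hn] with c hc
    exact hc.le.trans (le_iSup (fun n : ℕ => c ^ n * G.stepVal top n s) n)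
  have : (nhdsWithin (1 : ℝ≥0∞) (Set.Iio 1)).NeBot := nhdsLT_neBot_of_exists_lt ⟨0, one_pos⟩
  obtain ⟨c, hc, hc1⟩ := (((Filter.eventually_all_finite hS₀).2 hev).and
    self_mem_nhdsWithin).exists
  exact ⟨c, hc1, hc⟩

end Game

/-- Proposition 2: if all Min action sets are finite, then for
every ε > 0 and finite set S₀ of states, Max has a memoryless strategy, with
finite support everywhere, that is ε-optimal for Reach(⊤) from every state in S₀. -/
theorem stmt7 {S A B : Type} [Countable S] [Countable A] [Countable B]
    (G : Game S A B) (top : S) (htop : G.IsSink top)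
    (hB : ∀ s, (G.actB s).Finite)
    (P : (Hist S A B → PMF A) → (Hist S A B → PMF B) → S →
      MeasureTheory.Measure (Play S A B))
    (hP : ∀ σ π s, G.IsMaxStrategy σ → G.IsMinStrategy π →
      G.IsPlayMeasure σ π s (P σ π s))
    (ε : ℝ≥0∞) (hε : 0 < ε) (S0 : Set S) (hS0 : S0.Finite) :
    ∃ σ, G.IsMaxStrategy σ ∧ Memoryless σ ∧
      (∀ s ∈ S0, ∀ π, G.IsMinStrategy π →
        G.val P (Reaches top) s - ε ≤ P σ π s (Reaches top)) ∧
      (∀ s : S, ((σ (([], s) : Hist S A B)).support).Finite) := by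
  obtain ⟨c, hc, hcS⟩ := G.exists_lt_one_limVal_sub_le_discVal top hε hS0
  obtain ⟨σ, hσ, hmem, hfin, h⟩ := G.exists_memoryless_discVal_le hc top
  refine ⟨σ, hσ, hmem, fun s hs π hπ => ?_, hfin⟩
  rw [(hP σ π s hσ hπ).reaches_eq_iSup]
  calc G.val P (Reaches top) s - ε ≤ G.limVal top s - ε :=
        tsub_le_tsub_right (G.val_le_limVal hB P hP top s) ε
    _ ≤ G.discVal c top s := hcS s hs
    _ ≤ _ := h π hπ [] s
end
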